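/- (Stability of the Lax-Wendroff scheme in a quarter-space with Neumann extrapolation and corner extrapolation.) Let a < 0, b < 0, λ > 0, μ > 0 satisfy the CFL condition (λa)² + (μb)² ≤ 1/2, and set α := λa, β := μb. Let u ∈ 𝔥, define on the interior indices 𝔦: v := −α D₁,₀ u − β D₂,₀ u and w := −(α²/2) Δ₁ u − (β²/2) Δ₂ u − αβ D₁,₀ D₂,₀ u + ((α²+β²)/8) Δ₁ Δ₂ u, and let u' ∈ 𝔥 be such that u'_{j,k} = u_{j,k} − w_{j,k} + v_{j,k} for all (j,k) ∈ 𝔦 (one step of the scheme with the extrapolation boundary and corner conditions). Then ‖u'‖²_{ℓ²(𝔦)} − ‖u‖²_{ℓ²(𝔦)} + (λ|a|/8)·∑_{k≥0}(u_{0,k})² + (μ|b|/8)·∑_{j≥0}(u_{j,0})² + ((μb)²/32)·((λa)²+(μb)²)·∑_{k≥0}((Δ₂ u)_{0,k})² + ((λa)²/32)·((λa)²+(μb)²)·∑_{j≥0}((Δ₁ u)_{j,0})² ≤ 0. -/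

import Mathlib

noncomputable section

/-- Forward difference in the first variable. -/
def D1p (u : ℤ → ℤ → ℝ) : ℤ → ℤ → ℝ := fun j k => u (j + 1) k - u j k
/-- Backward difference in the first variable. -/
def D1m (u : ℤ → ℤ → ℝ) : ℤ → ℤ → ℝ := fun j k => u j k - u (j - 1) k
/-- Forward difference in the second variable. -/
def D2p (u : ℤ → ℤ → ℝ) : ℤ → ℤ → ℝ := fun j k => u j (k + 1) - u j k
/-- Backward difference in the second variable. -/
def D2m (u : ℤ → ℤ → ℝ) : ℤ → ℤ → ℝ := fun j k => u j k - u j (k - 1)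
/-- Centered difference in the first variable. -/
def D10 (u : ℤ → ℤ → ℝ) : ℤ → ℤ → ℝ := fun j k => (D1p u j k + D1m u j k) / 2
/-- Centered difference in the second variable. -/
def D20 (u : ℤ → ℤ → ℝ) : ℤ → ℤ → ℝ := fun j k => (D2p u j k + D2m u j k) / 2
/-- Discrete Laplacian in the first variable. -/
def L1 (u : ℤ → ℤ → ℝ) : ℤ → ℤ → ℝ := D1p (D1m u)
/-- Discrete Laplacian in the second variable. -/
def L2 (u : ℤ → ℤ → ℝ) : ℤ → ℤ → ℝ := D2p (D2m u)

/-- Squared ℓ²(ℤ²) norm. -/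
def sqZ (u : ℤ → ℤ → ℝ) : ℝ := ∑' p : ℤ × ℤ, (u p.1 p.2) ^ 2
/-- ℓ²(ℤ²) scalar product. -/
def ipZ (u v : ℤ → ℤ → ℝ) : ℝ := ∑' p : ℤ × ℤ, u p.1 p.2 * v p.1 p.2

/-- Squared ℓ²(𝓘) norm over the interior indices 𝓘 = ℕ × ℤ of the half-space grid. -/
def sqH (u : ℤ → ℤ → ℝ) : ℝ := ∑' p : ℕ × ℤ, (u (p.1 : ℤ) p.2) ^ 2
/-- ℓ²(𝓘) scalar product over the interior indices 𝓘 = ℕ × ℤ. -/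
def ipH (u v : ℤ → ℤ → ℝ) : ℝ := ∑' p : ℕ × ℤ, u (p.1 : ℤ) p.2 * v (p.1 : ℤ) p.2
/-- Membership in ℋ : square-summable on the half-space grid and satisfying the
extrapolation (Neumann) boundary condition `u (-1) k = u 0 k`. -/
def memH (u : ℤ → ℤ → ℝ) : Prop :=
  (∀ k : ℤ, u (-1) k = u 0 k) ∧ Summable (fun p : ℕ × ℤ => (u (p.1 : ℤ) p.2) ^ 2)

/-- Squared ℓ²(𝔦) norm over the interior indices 𝔦 = ℕ × ℕ of the quarter-space grid. -/
def sqQ (u : ℤ → ℤ → ℝ) : ℝ := ∑' p : ℕ × ℕ, (u (p.1 : ℤ) (p.2 : ℤ)) ^ 2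
/-- ℓ²(𝔦) scalar product over the interior indices 𝔦 = ℕ × ℕ. -/
def ipQ (u v : ℤ → ℤ → ℝ) : ℝ :=
  ∑' p : ℕ × ℕ, u (p.1 : ℤ) (p.2 : ℤ) * v (p.1 : ℤ) (p.2 : ℤ)
/-- Membership in 𝔥 : square-summable on the quarter-space grid, satisfying the
extrapolation boundary conditions on both sides and the corner condition. -/
def memQ (u : ℤ → ℤ → ℝ) : Prop :=
  (∀ k : ℤ, -1 ≤ k → u (-1) k = u 0 k) ∧ (∀ j : ℤ, 0 ≤ j → u j (-1) = u j 0) ∧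
    Summable (fun p : ℕ × ℕ => (u (p.1 : ℤ) (p.2 : ℤ)) ^ 2)

/-- The skew-selfadjoint part `v` in the decomposition of the Lax-Wendroff scheme. -/
def vop (α β : ℝ) (u : ℤ → ℤ → ℝ) : ℤ → ℤ → ℝ :=
  fun j k => -α * D10 u j k - β * D20 u j k
/-- The selfadjoint part `w` in the decomposition of the Lax-Wendroff scheme. -/
def wop (α β : ℝ) (u : ℤ → ℤ → ℝ) : ℤ → ℤ → ℝ :=
  fun j k => -(α ^ 2 / 2) * L1 u j k - (β ^ 2 / 2) * L2 u j k
    - α * β * D10 (D20 u) j k + ((α ^ 2 + β ^ 2) / 8) * L1 (L2 u) j k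

def EE (f : ℤ → ℤ → ℝ) : Prop := Summable fun p : ℤ × ℤ => (f p.1 p.2) ^ 2
def PP (f : ℤ → ℤ → ℝ) : Prop := Summable fun p : ℤ × ℤ => f p.1 p.2

theorem PP.add {f g : ℤ → ℤ → ℝ} (hf : PP f) (hg : PP g) : PP (fun j k => f j k + g j k) :=
  Summable.add hf hg
theorem PP.sub {f g : ℤ → ℤ → ℝ} (hf : PP f) (hg : PP g) : PP (fun j k => f j k - g j k) :=
  Summable.sub hf hg
theorem PP.smul {f : ℤ → ℤ → ℝ} (c : ℝ) (hf : PP f) : PP (fun j k => c * f j k) :=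
  Summable.mul_left c hf
theorem EE.mul {f g : ℤ → ℤ → ℝ} (hf : EE f) (hg : EE g) : PP (fun j k => f j k * g j k) := by
  refine Summable.of_norm_bounded (Summable.add hf hg) ?_
  intro p
  rw [Real.norm_eq_abs, abs_le]
  constructor <;> nlinarith [sq_nonneg (f p.1 p.2 + g p.1 p.2), sq_nonneg (f p.1 p.2 - g p.1 p.2), sq_nonneg (f p.1 p.2), sq_nonneg (g p.1 p.2)]
theorem EE.sq {f : ℤ → ℤ → ℝ} (hf : EE f) : PP (fun j k => (f j k) ^ 2) := hf
theorem EE.add {f g : ℤ → ℤ → ℝ} (hf : EE f) (hg : EE g) : EE (fun j k => f j k + g j k) := by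
  have h := ((hf.sq.add hg.sq).add ((hf.mul hg).smul 2))
  refine Summable.congr h ?_
  intro p; dsimp only; ring
theorem EE.smul {f : ℤ → ℤ → ℝ} (c : ℝ) (hf : EE f) : EE (fun j k => c * f j k) := by
  refine Summable.congr (hf.sq.smul (c ^ 2)) ?_
  intro p; dsimp only; ring
theorem EE.sub {f g : ℤ → ℤ → ℝ} (hf : EE f) (hg : EE g) : EE (fun j k => f j k - g j k) := by
  have h := hf.add (hg.smul (-1))
  refine Summable.congr h ?_
  intro p; dsimp only; ring
theorem EE.shift {f : ℤ → ℤ → ℝ} (m n : ℤ) (hf : EE f) : EE (fun j k => f (j + m) (k + n)) := by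
  have := ((Equiv.addRight m).prodCongr (Equiv.addRight n)).summable_iff.mpr hf
  exact this
theorem EE.s1 {f : ℤ → ℤ → ℝ} (hf : EE f) : EE (fun j k => f (j - 1) k) := by
  simpa [sub_eq_add_neg] using hf.shift (-1) 0
theorem EE.s2 {f : ℤ → ℤ → ℝ} (hf : EE f) : EE (fun j k => f j (k - 1)) := by
  simpa [sub_eq_add_neg] using hf.shift 0 (-1)
theorem EE.D1p {f : ℤ → ℤ → ℝ} (hf : EE f) : EE (D1p f) := by
  have := (hf.shift 1 0).sub hf
  simp only [add_zero] at this
  exact this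
theorem EE.D2p {f : ℤ → ℤ → ℝ} (hf : EE f) : EE (D2p f) := by
  have := (hf.shift 0 1).sub hf
  simp only [add_zero] at this
  exact this
theorem EE.D1m {f : ℤ → ℤ → ℝ} (hf : EE f) : EE (D1m f) := hf.sub hf.s1
theorem EE.D2m {f : ℤ → ℤ → ℝ} (hf : EE f) : EE (D2m f) := hf.sub hf.s2
theorem EE.D10 {f : ℤ → ℤ → ℝ} (hf : EE f) : EE (D10 f) := by
  refine Summable.congr ((hf.D1p.add hf.D1m).smul (1 / 2)) ?_
  intro p; dsimp only [_root_.D10]; ring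
theorem EE.D20 {f : ℤ → ℤ → ℝ} (hf : EE f) : EE (D20 f) := by
  refine Summable.congr ((hf.D2p.add hf.D2m).smul (1 / 2)) ?_
  intro p; dsimp only [_root_.D20]; ring
theorem EE.L1 {f : ℤ → ℤ → ℝ} (hf : EE f) : EE (L1 f) := hf.D1m.D1p
theorem EE.L2 {f : ℤ → ℤ → ℝ} (hf : EE f) : EE (L2 f) := hf.D2m.D2p

theorem castinj : Function.Injective (fun p : ℕ × ℕ => ((p.1 : ℤ), (p.2 : ℤ))) := by
  intro p q h
  simp only [Prod.mk.injEq, Nat.cast_inj] at h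
  exact Prod.ext h.1 h.2

theorem PP.nat {f : ℤ → ℤ → ℝ} (hf : PP f) :
    Summable (fun p : ℕ × ℕ => f (p.1 : ℤ) (p.2 : ℤ)) :=
  Summable.comp_injective hf castinj
theorem PP.row {f : ℤ → ℤ → ℝ} (hf : PP f) (j : ℤ) :
    Summable (fun k : ℕ => f j (k : ℤ)) := by
  refine Summable.comp_injective (i := fun k : ℕ => (j, (k : ℤ))) hf ?_
  intro a b h; simpa using h
theorem PP.swap {f : ℤ → ℤ → ℝ} (hf : PP f) : PP (fun j k => f k j) :=
  (Equiv.prodComm ℤ ℤ).summable_iff.mpr hf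
theorem PP.col {f : ℤ → ℤ → ℝ} (hf : PP f) (k : ℤ) :
    Summable (fun j : ℕ => f (j : ℤ) k) := hf.swap.row k

theorem tel1 {f : ℤ → ℤ → ℝ} (hf : PP f) :
    HasSum (fun p : ℕ × ℕ => f ((p.1 : ℤ) + 1) (p.2 : ℤ) - f (p.1 : ℤ) (p.2 : ℤ))
      (-∑' k : ℕ, f 0 (k : ℤ)) := by
  have h0 := hf.nat
  have h1 : Summable (fun p : ℕ × ℕ => f ((p.1 : ℤ) + 1) (p.2 : ℤ)) := by
    refine Summable.comp_injective (i := fun p : ℕ × ℕ => ((p.1 : ℤ) + 1, (p.2 : ℤ))) hf ?_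
    intro p q h
    simp only [Prod.mk.injEq, Nat.cast_inj, add_left_inj] at h
    exact Prod.ext h.1 h.2
  have hs := (h1.sub h0).hasSum
  have key : (-∑' k : ℕ, f 0 (k : ℤ)) = ∑' p : ℕ × ℕ, (f ((p.1 : ℤ) + 1) (p.2 : ℤ) - f (p.1 : ℤ) (p.2 : ℤ)) := ?_
  · rw [key]; exact hs
  rw [h1.tsum_sub h0, h0.tsum_prod, h1.tsum_prod]
  have hR : Summable (fun j : ℕ => ∑' k : ℕ, f (j : ℤ) (k : ℤ)) := h0.prod
  rw [hR.tsum_eq_zero_add]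
  push_cast
  ring

theorem tel2 {f : ℤ → ℤ → ℝ} (hf : PP f) :
    HasSum (fun p : ℕ × ℕ => f (p.1 : ℤ) ((p.2 : ℤ) + 1) - f (p.1 : ℤ) (p.2 : ℤ))
      (-∑' j : ℕ, f (j : ℤ) 0) := by
  have := tel1 hf.swap
  exact (Equiv.prodComm ℕ ℕ).hasSum_iff.mp this

theorem tel0 {h : ℕ → ℝ} (hh : Summable h) :
    ∑' k : ℕ, (h (k + 1) - h k) = - h 0 := by
  have h1 : Summable (fun k => h (k + 1)) := (summable_nat_add_iff 1).mpr hh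
  rw [h1.tsum_sub hh, hh.tsum_eq_zero_add]; ring

def rr (j : ℤ) : ℤ := if 0 ≤ j then j else -1 - j
def UU (u : ℤ → ℤ → ℝ) : ℤ → ℤ → ℝ := fun j k => u (rr j) (rr k)

theorem sumZ {f : ℤ → ℝ} (hf : Summable fun n : ℕ => f n) : Summable fun n : ℤ => f (rr n) := by
  refine Summable.of_nat_of_neg_add_one ?_ ?_
  · refine hf.congr ?_
    intro n; simp [rr]
  · refine hf.congr ?_
    intro n
    have : ¬ (0 : ℤ) ≤ -((n : ℤ) + 1) := by omega
    rw [rr, if_neg this]; congr 1; omega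

theorem UU_EE {u : ℤ → ℤ → ℝ}
    (h : Summable (fun p : ℕ × ℕ => (u (p.1 : ℤ) (p.2 : ℤ)) ^ 2)) : EE (UU u) := by
  have step1 : Summable (fun p : ℕ × ℤ => (u (p.1 : ℤ) (rr p.2)) ^ 2) := by
    rw [summable_prod_of_nonneg (fun p => sq_nonneg _)] at h ⊢
    refine ⟨fun j => sumZ (f := fun n => u j n ^ 2) (h.1 j), ?_⟩
    have h2 := h.2.mul_left 2
    refine h2.congr ?_
    intro j
    have hs := h.1 j
    dsimp only at hs ⊢
    have e : ∀ n : ℕ, rr (-((n : ℤ) + 1)) = n := by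
      intro n
      have : ¬ (0 : ℤ) ≤ -((n : ℤ) + 1) := by omega
      rw [rr, if_neg this]; omega
    have e' : ∀ n : ℕ, rr (n : ℤ) = n := by intro n; simp [rr]
    rw [tsum_of_nat_of_neg_add_one]
    · simp only [e, e']; ring
    · simpa only [e'] using hs
    · simpa only [e] using hs
  have step2 : Summable (fun p : ℤ × ℕ => (u (p.2 : ℤ) (rr p.1)) ^ 2) :=
    (Equiv.prodComm ℤ ℕ).summable_iff.mpr step1
  have step3 : Summable (fun p : ℤ × ℤ => (u (rr p.2) (rr p.1)) ^ 2) := by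
    have h := step2
    rw [summable_prod_of_nonneg (fun p => sq_nonneg _)] at h ⊢
    refine ⟨fun j => sumZ (f := fun n => u n (rr j) ^ 2) (h.1 j), ?_⟩
    have h2 := h.2.mul_left 2
    refine h2.congr ?_
    intro j
    have hs := h.1 j
    dsimp only at hs ⊢
    have e : ∀ n : ℕ, rr (-((n : ℤ) + 1)) = n := by
      intro n
      have : ¬ (0 : ℤ) ≤ -((n : ℤ) + 1) := by omega
      rw [rr, if_neg this]; omega
    have e' : ∀ n : ℕ, rr (n : ℤ) = n := by intro n; simp [rr]
    rw [tsum_of_nat_of_neg_add_one]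
    · simp only [e, e']; ring
    · simpa only [e'] using hs
    · simpa only [e] using hs
  exact (Equiv.prodComm ℤ ℤ).summable_iff.mpr step3

theorem UU_eq {u : ℤ → ℤ → ℝ} (hu : memQ u) (j k : ℤ) (hj : -1 ≤ j) (hk : -1 ≤ k) :
    UU u j k = u j k := by
  obtain ⟨h1, h2, -⟩ := hu
  unfold UU
  have e : ∀ n : ℤ, 0 ≤ n → rr n = n := by intro n hn; simp [rr, hn]
  have e1 : rr (-1) = 0 := by simp [rr]
  rcases (by omega : j = -1 ∨ 0 ≤ j) with rfl | hj' <;>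
  rcases (by omega : k = -1 ∨ 0 ≤ k) with rfl | hk'
  · rw [e1, h1 _ le_rfl, h2 _ le_rfl]
  · rw [e1, e _ hk', h1 _ hk]
  · rw [e1, e _ hj', h2 _ hj']
  · rw [e _ hj', e _ hk']

theorem UU_b1 (u : ℤ → ℤ → ℝ) (k : ℤ) : UU u (-1) k = UU u 0 k := by simp [UU, rr]
theorem UU_b2 (u : ℤ → ℤ → ℝ) (k : ℤ) : UU u k (-1) = UU u k 0 := by simp [UU, rr]

def gg (u : ℤ → ℤ → ℝ) : ℤ → ℤ → ℝ := D1p (D2p u)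
def zz (u : ℤ → ℤ → ℝ) : ℤ → ℤ → ℝ := D10 (D2p u)
def zz' (u : ℤ → ℤ → ℝ) : ℤ → ℤ → ℝ := D20 (D1p u)

def Phi (α β : ℝ) (u : ℤ → ℤ → ℝ) : ℤ → ℤ → ℝ := fun j k =>
  (-α) * (u (j - 1) k * u j k) + (α ^ 2 / 2) * (u j k ^ 2 - u (j - 1) k ^ 2)
  + (α * β) * (u (j - 1) k * D20 u j k + u j k * D20 u (j - 1) k)
  + (-((α ^ 2 + β ^ 2) / 4)) * (u j k * D1m (L2 u) j k)
  + (-(α ^ 3 / 2)) * (D1m u j k ^ 2)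
  + (α * β ^ 2 / 2) * (D2p u (j - 1) k * D2p u j k)
  + (-(α ^ 2 * β)) * (D20 u j k * D1m u j k)
  + (-(α * β ^ 2)) * (D20 u (j - 1) k * D20 u j k)
  + (-(α * (α ^ 2 + β ^ 2) / 8)) * (D1m (D2p u) j k ^ 2)
  + (β * (α ^ 2 + β ^ 2) / 4) * (D20 u j k * D1m (L2 u) j k)
  + (β ^ 2 * (α ^ 2 + β ^ 2) / 8) * (L2 u j k ^ 2)
  + (-(β ^ 2 * (α ^ 2 + β ^ 2) / 8)) * (L2 u j k * D1m (L2 u) j k)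
  + (-(α * β ^ 3 / 2)) * (L2 u j k * zz' u (j - 1) k)
  + (-(α ^ 2 * (α ^ 2 + β ^ 2) / 4)) * (gg u (j - 1) k ^ 2)
  + (-(β ^ 2 * (α ^ 2 + β ^ 2) / 8)) * (zz' u (j - 1) k ^ 2)
  + (-(β ^ 2 * (α ^ 2 + β ^ 2) / 32)) * (D1m (L2 u) j k ^ 2)
  + (-(α * β * (α ^ 2 + β ^ 2) / 8)) * (gg u (j - 1) k ^ 2 - gg u (j - 1) (k - 1) ^ 2)

def Psi (α β : ℝ) (u : ℤ → ℤ → ℝ) : ℤ → ℤ → ℝ := fun j k =>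
  (-β) * (u j (k - 1) * u j k) + (β ^ 2 / 2) * (u j k ^ 2 - u j (k - 1) ^ 2)
  + ((α ^ 2 + β ^ 2) / 4) * (D1p u j k * D2m (D1p u) j k)
  + (-(β ^ 3 / 2)) * (D2m u j k ^ 2)
  + (α ^ 2 * β / 2) * (D1p u j (k - 1) * D1p u j k)
  + (-(α * β ^ 2)) * (D10 u j k * D2m u j k)
  + (-(α ^ 2 * β)) * (D10 u j (k - 1) * D10 u j k)
  + (-(β * (α ^ 2 + β ^ 2) / 8)) * (D2m (D1p u) j k ^ 2)
  + (α * (α ^ 2 + β ^ 2) / 4) * (D10 u j k * D2m (L1 u) j k)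
  + (α ^ 2 * (α ^ 2 + β ^ 2) / 8) * (L1 u j k ^ 2)
  + (-(α ^ 2 * (α ^ 2 + β ^ 2) / 8)) * (L1 u j k * D2m (L1 u) j k)
  + (-(α ^ 3 * β / 2)) * (L1 u j k * zz u j (k - 1))
  + (-(β ^ 2 * (α ^ 2 + β ^ 2) / 4)) * (gg u j (k - 1) ^ 2)
  + (-(α ^ 2 * (α ^ 2 + β ^ 2) / 8)) * (zz u j (k - 1) ^ 2)
  + (-(α ^ 2 * (α ^ 2 + β ^ 2) / 32)) * (D2m (L1 u) j k ^ 2)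

theorem Phi_PP (α β : ℝ) {u : ℤ → ℤ → ℝ} (h : EE u) : PP (Phi α β u) := by
  have hg : EE (gg u) := h.D2p.D1p
  have hz : EE (zz' u) := h.D1p.D20
  refine PP.add (PP.add (PP.add (PP.add (PP.add (PP.add (PP.add (PP.add (PP.add (PP.add (PP.add (PP.add (PP.add (PP.add (PP.add (PP.add ?_ ?_) ?_) ?_) ?_) ?_) ?_) ?_) ?_) ?_) ?_) ?_) ?_) ?_) ?_) ?_) ?_ <;> refine PP.smul _ ?_
  · exact h.s1.mul h
  · exact h.sq.sub h.s1.sq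
  · exact (h.s1.mul h.D20).add (h.mul h.D20.s1)
  · exact h.mul h.L2.D1m
  · exact h.D1m.sq
  · exact h.D2p.s1.mul h.D2p
  · exact h.D20.mul h.D1m
  · exact h.D20.s1.mul h.D20
  · exact h.D2p.D1m.sq
  · exact h.D20.mul h.L2.D1m
  · exact h.L2.sq
  · exact h.L2.mul h.L2.D1m
  · exact h.L2.mul hz.s1
  · exact hg.s1.sq
  · exact hz.s1.sq
  · exact h.L2.D1m.sq
  · exact hg.s1.sq.sub hg.s1.s2.sq

theorem Psi_PP (α β : ℝ) {u : ℤ → ℤ → ℝ} (h : EE u) : PP (Psi α β u) := by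
  have hg : EE (gg u) := h.D2p.D1p
  have hz : EE (zz u) := h.D2p.D10
  refine PP.add (PP.add (PP.add (PP.add (PP.add (PP.add (PP.add (PP.add (PP.add (PP.add (PP.add (PP.add (PP.add (PP.add ?_ ?_) ?_) ?_) ?_) ?_) ?_) ?_) ?_) ?_) ?_) ?_) ?_) ?_) ?_ <;> refine PP.smul _ ?_
  · exact h.s2.mul h
  · exact h.sq.sub h.s2.sq
  · exact h.D1p.mul h.D1p.D2m
  · exact h.D2m.sq
  · exact h.D1p.s2.mul h.D1p
  · exact h.D10.mul h.D2m
  · exact h.D10.s2.mul h.D10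
  · exact h.D1p.D2m.sq
  · exact h.D10.mul h.L1.D2m
  · exact h.L1.sq
  · exact h.L1.mul h.L1.D2m
  · exact h.L1.mul hz.s2
  · exact hg.s2.sq
  · exact hz.s2.sq
  · exact h.L1.D2m.sq

/-- the pointwise dissipation -/
def SS (α β : ℝ) (u : ℤ → ℤ → ℝ) : ℤ → ℤ → ℝ := fun j k =>
  (1 - 2 * (α ^ 2 + β ^ 2)) * ((α ^ 2 * L1 u j k ^ 2 + β ^ 2 * L2 u j k ^ 2
      + (α ^ 2 + β ^ 2) * gg u j k ^ 2) / 4)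
  + (α ^ 2 * β ^ 2 / 4) * (L1 u j k - L2 u j k) ^ 2
  + α ^ 2 * ((α ^ 2 + β ^ 2) / 4 * ((L1 u j k + L1 u j (k + 1)) / 2) ^ 2
      - α * β * (((L1 u j k + L1 u j (k + 1)) / 2) * zz u j k)
      + (α ^ 2 + β ^ 2) / 4 * zz u j k ^ 2)
  + β ^ 2 * ((α ^ 2 + β ^ 2) / 4 * ((L2 u j k + L2 u (j + 1) k) / 2) ^ 2
      - α * β * (((L2 u j k + L2 u (j + 1) k) / 2) * zz' u j k)
      + (α ^ 2 + β ^ 2) / 4 * zz' u j k ^ 2)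
  + ((α ^ 2 + β ^ 2) ^ 2 / 4 - α ^ 2 * β ^ 2) * (D10 (D20 u) j k) ^ 2
  + (α ^ 2 + β ^ 2) / 4 * ((α ^ 2 + β ^ 2) / 4 * (zz' u j k - zz' u (j - 1) k) ^ 2
      - α * β * ((zz' u j k - zz' u (j - 1) k) * (zz u j k - zz u j (k - 1)))
      + (α ^ 2 + β ^ 2) / 4 * (zz u j k - zz u j (k - 1)) ^ 2)

theorem quadnn (α β x z : ℝ) :
    0 ≤ (α ^ 2 + β ^ 2) / 4 * x ^ 2 - α * β * (x * z) + (α ^ 2 + β ^ 2) / 4 * z ^ 2 := by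
  nlinarith [sq_nonneg (α * x - β * z), sq_nonneg (α * z - β * x)]

theorem SS_nonneg (α β : ℝ) (hC : α ^ 2 + β ^ 2 ≤ 1 / 2) (u : ℤ → ℤ → ℝ) (j k : ℤ) :
    0 ≤ SS α β u j k := by
  unfold SS
  have h1 : 0 ≤ 1 - 2 * (α ^ 2 + β ^ 2) := by linarith
  have h2 : 0 ≤ (α ^ 2 + β ^ 2) ^ 2 / 4 - α ^ 2 * β ^ 2 := by nlinarith [sq_nonneg (α ^ 2 - β ^ 2)]
  have q1 := quadnn α β ((L1 u j k + L1 u j (k + 1)) / 2) (zz u j k)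
  have q2 := quadnn α β ((L2 u j k + L2 u (j + 1) k) / 2) (zz' u j k)
  have q3 := quadnn α β (zz' u j k - zz' u (j - 1) k) (zz u j k - zz u j (k - 1))
  have r1 := mul_nonneg (sq_nonneg α) q1
  have r2 := mul_nonneg (sq_nonneg β) q2
  have r3 := mul_nonneg (by positivity : 0 ≤ (α ^ 2 + β ^ 2) / 4) q3
  have r4 := mul_nonneg h2 (sq_nonneg (D10 (D20 u) j k))
  have r5 := mul_nonneg h1 (by positivity : 0 ≤ ((α ^ 2 * L1 u j k ^ 2 + β ^ 2 * L2 u j k ^ 2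
      + (α ^ 2 + β ^ 2) * gg u j k ^ 2) / 4))
  have r6 : 0 ≤ (α ^ 2 * β ^ 2 / 4) * (L1 u j k - L2 u j k) ^ 2 := by positivity
  linarith
set_option maxHeartbeats 4000000 in
theorem pointwise (α β : ℝ) (u : ℤ → ℤ → ℝ) (j k : ℤ) :
    (u j k - wop α β u j k + vop α β u j k) ^ 2 - u j k ^ 2 + SS α β u j k
      = (Phi α β u (j + 1) k - Phi α β u j k) + (Psi α β u j (k + 1) - Psi α β u j k) := by
  simp only [SS, Phi, Psi, wop, vop, gg, zz, zz', L1, L2, D10, D20, D1p, D1m, D2p, D2m,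
    add_sub_cancel_right, sub_add_cancel]
  generalize u (j - 1) (k - 1) = a1
  generalize u (j - 1) k = a2
  generalize u (j - 1) (k + 1) = a3
  generalize u j (k - 1) = a4
  generalize u j k = a5
  generalize u j (k + 1) = a6
  generalize u (j + 1) (k - 1) = a7
  generalize u (j + 1) k = a8
  generalize u (j + 1) (k + 1) = a9
  ring
theorem arith1 (A b S D L f : ℝ) (hA : 0 < A) (hb : 0 < b) (hC : A ^ 2 + b ^ 2 ≤ 1 / 2)
    (hL0 : 0 ≤ L) (hL : L ≤ 4 * D) (hD : D ≤ 4 * S - 2 * f) (hf : 0 ≤ f) (hfS : f ≤ S) :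
    0 ≤ 7 / 8 * A * S + A * b ^ 2 / 2 * D - A * b ^ 2 / 4 * L
      + 3 / 32 * (A ^ 2 + b ^ 2) * b ^ 2 * L - A * b / 2 * f := by
  have hD0 : 0 ≤ D := by linarith
  have hb1 : b ≤ 3 / 4 := by nlinarith
  have hb2 : b ^ 2 ≤ 1 / 2 := by nlinarith
  have hb3 : b ≤ 71 / 100 := by nlinarith
  have hAf : 0 ≤ A * f := by positivity
  have hAS : A * f ≤ A * S := mul_le_mul_of_nonneg_left hfS hA.le
  have hbase : 0 ≤ 7 / 8 * A * S - A * b / 2 * f := by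
    nlinarith [mul_nonneg hAf (by linarith : 0 ≤ 3 / 4 - b)]
  have hρ : 0 ≤ (A ^ 2 + b ^ 2) * b ^ 2 := by positivity
  have h4 : 0 ≤ 7 / 8 * A * S + b ^ 2 * (3 / 8 * (A ^ 2 + b ^ 2) - A / 2) * D - A * b / 2 * f := by
    rcases le_total 0 (3 / 8 * (A ^ 2 + b ^ 2) - A / 2) with h | h
    · have : 0 ≤ b ^ 2 * (3 / 8 * (A ^ 2 + b ^ 2) - A / 2) * D := by positivity
      linarith
    · have e1 : b ^ 2 * (3 / 8 * (A ^ 2 + b ^ 2) - A / 2) * (4 * S - 2 * f)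
          ≤ b ^ 2 * (3 / 8 * (A ^ 2 + b ^ 2) - A / 2) * D :=
        mul_le_mul_of_nonpos_left hD (mul_nonpos_of_nonneg_of_nonpos (sq_nonneg b) h)
      have c1 : 0 ≤ 7 / 8 * A - 2 * A * b ^ 2 + 3 / 2 * ((A ^ 2 + b ^ 2) * b ^ 2) := by
        rcases le_total (b ^ 2) (7 / 16) with h' | h'
        · nlinarith
        · have hA1 : A ≤ 1 / 4 := by nlinarith
          have : (7 / 16) ^ 2 ≤ (b ^ 2) ^ 2 := by gcongr
          nlinarith [mul_nonneg (sq_nonneg A) (sq_nonneg b)]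
      have c2 : 0 ≤ 7 / 8 - b ^ 2 - b / 2 := by nlinarith
      have p1 := mul_nonneg c1 (by linarith : 0 ≤ S - f)
      have p2 := mul_nonneg c2 hAf
      have p3 := mul_nonneg hρ hf
      nlinarith
  rcases le_total 0 (3 / 32 * (A ^ 2 + b ^ 2) - A / 4) with h | h
  · have q1 : 0 ≤ b ^ 2 * (3 / 32 * (A ^ 2 + b ^ 2) - A / 4) * L := by positivity
    have q2 : 0 ≤ A * b ^ 2 / 2 * D := by positivity
    linarith
  · have q1 : b ^ 2 * (3 / 32 * (A ^ 2 + b ^ 2) - A / 4) * (4 * D) ≤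
        b ^ 2 * (3 / 32 * (A ^ 2 + b ^ 2) - A / 4) * L :=
      mul_le_mul_of_nonpos_left hL (mul_nonpos_of_nonneg_of_nonpos (sq_nonneg b) h)
    linarith

theorem sq_add_summable {f g : ℕ → ℝ} (hf : Summable fun k => f k ^ 2)
    (hg : Summable fun k => g k ^ 2) (s t : ℝ) : Summable fun k => (s * f k + t * g k) ^ 2 := by
  refine Summable.of_nonneg_of_le (fun k => sq_nonneg _) (fun k => ?_)
    ((hf.mul_left (2 * s ^ 2)).add (hg.mul_left (2 * t ^ 2)))
  nlinarith [sq_nonneg (s * f k - t * g k)]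

theorem oneD (α β : ℝ) (hα : α < 0) (hβ : β < 0) (hC : α ^ 2 + β ^ 2 ≤ 1 / 2)
    (φ : ℤ → ℝ) (hφ : Summable fun k : ℕ => φ k ^ 2) (hb : φ (-1) = φ 0) :
    (∑' k : ℕ, (α * φ k ^ 2 - α * β ^ 2 / 2 * (φ (k + 1) - φ k) ^ 2
      + α * β ^ 2 * ((φ (k + 1) - φ k + (φ k - φ (k - 1))) / 2) ^ 2
      - β ^ 2 * (α ^ 2 + β ^ 2) / 8 * (φ (k + 1) - φ k - (φ k - φ (k - 1))) ^ 2))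
    + (-α) / 8 * (∑' k : ℕ, φ k ^ 2)
    + β ^ 2 / 32 * (α ^ 2 + β ^ 2) * (∑' k : ℕ, (φ (k + 1) - φ k - (φ k - φ (k - 1))) ^ 2)
    + α * β / 2 * φ 0 ^ 2 ≤ 0 := by
  have hφ1 : Summable fun k : ℕ => φ (k + 1) ^ 2 := by
    have := (summable_nat_add_iff 1).mpr hφ
    simpa using this
  have hD : Summable fun k : ℕ => (φ (k + 1) - φ k) ^ 2 := by
    refine (sq_add_summable hφ1 hφ 1 (-1)).congr fun k => ?_
    ring
  have hDm : Summable fun k : ℕ => (φ k - φ (k - 1)) ^ 2 := by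
    rw [← summable_nat_add_iff 1]
    refine hD.congr fun k => ?_
    push_cast
    rw [add_sub_cancel_right]
  have hB : Summable fun k : ℕ => ((φ (k + 1) - φ k + (φ k - φ (k - 1))) / 2) ^ 2 := by
    refine (sq_add_summable hD hDm (1 / 2) (1 / 2)).congr fun k => ?_
    ring
  have hL : Summable fun k : ℕ => (φ (k + 1) - φ k - (φ k - φ (k - 1))) ^ 2 := by
    refine (sq_add_summable hD hDm 1 (-1)).congr fun k => ?_
    ring
  have hsum := ((((hφ.mul_left α).hasSum.sub (hD.mul_left (α * β ^ 2 / 2)).hasSum).add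
    (hB.mul_left (α * β ^ 2)).hasSum).sub (hL.mul_left (β ^ 2 * (α ^ 2 + β ^ 2) / 8)).hasSum).tsum_eq
  rw [hsum, tsum_mul_left, tsum_mul_left, tsum_mul_left, tsum_mul_left]
  have hDD : ∑' k : ℕ, (φ k - φ (k - 1)) ^ 2 = ∑' k : ℕ, (φ (k + 1) - φ k) ^ 2 := by
    rw [hDm.tsum_eq_zero_add]
    simp only [Nat.cast_zero, zero_sub, hb, sub_self, Nat.cast_add, Nat.cast_one,
      add_sub_cancel_right]
    ring
  have hφφ : ∑' k : ℕ, φ k ^ 2 = φ 0 ^ 2 + ∑' k : ℕ, φ (k + 1) ^ 2 := by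
    rw [hφ.tsum_eq_zero_add]
    simp
  have eB : ∑' k : ℕ, ((φ (k + 1) - φ k + (φ k - φ (k - 1))) / 2) ^ 2
      = ∑' k : ℕ, (φ (k + 1) - φ k) ^ 2
        - (∑' k : ℕ, (φ (k + 1) - φ k - (φ k - φ (k - 1))) ^ 2) / 4 := by
    have := (((hD.mul_left (1 / 2)).hasSum.add (hDm.mul_left (1 / 2)).hasSum).sub
      (hL.mul_left (1 / 4)).hasSum).tsum_eq
    rw [tsum_mul_left, tsum_mul_left, tsum_mul_left, hDD] at this
    have e : (fun k : ℕ => ((φ (k + 1) - φ k + (φ k - φ (k - 1))) / 2) ^ 2) = fun k : ℕ =>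
      (1 / 2 * (φ (k + 1) - φ k) ^ 2 + 1 / 2 * (φ k - φ (k - 1)) ^ 2
        - 1 / 4 * (φ (k + 1) - φ k - (φ k - φ (k - 1))) ^ 2) := by
      funext k; ring
    rw [e, this]; ring
  have iL : ∑' k : ℕ, (φ (k + 1) - φ k - (φ k - φ (k - 1))) ^ 2
      ≤ 4 * ∑' k : ℕ, (φ (k + 1) - φ k) ^ 2 := by
    have := hasSum_le (fun k : ℕ => (by nlinarith [sq_nonneg ((φ (k + 1) - φ k) + (φ k - φ (k - 1)))] :
      (φ (k + 1) - φ k - (φ k - φ (k - 1))) ^ 2 ≤ 2 * (φ (k + 1) - φ k) ^ 2 + 2 * (φ k - φ (k - 1)) ^ 2))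
      hL.hasSum ((hD.mul_left 2).hasSum.add (hDm.mul_left 2).hasSum)
    rw [tsum_mul_left, tsum_mul_left, hDD] at this
    linarith
  have iD : ∑' k : ℕ, (φ (k + 1) - φ k) ^ 2 ≤ 4 * (∑' k : ℕ, φ k ^ 2) - 2 * φ 0 ^ 2 := by
    have := hasSum_le (fun k : ℕ => (by nlinarith [sq_nonneg (φ (k + 1) + φ k)] :
      (φ (k + 1) - φ k) ^ 2 ≤ 2 * φ (k + 1) ^ 2 + 2 * φ k ^ 2))
      hD.hasSum ((hφ1.mul_left 2).hasSum.add (hφ.mul_left 2).hasSum)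
    rw [tsum_mul_left, tsum_mul_left] at this
    linarith
  have n1 : 0 ≤ ∑' k : ℕ, φ (k + 1) ^ 2 := tsum_nonneg fun k => sq_nonneg _
  have n2 : 0 ≤ ∑' k : ℕ, (φ (k + 1) - φ k - (φ k - φ (k - 1))) ^ 2 :=
    tsum_nonneg fun k => sq_nonneg _
  have key := arith1 (-α) (-β) _ _ _ (φ 0 ^ 2) (by linarith) (by linarith) (by nlinarith)
    n2 iL iD (sq_nonneg _) (by linarith)
  rw [eB]
  nlinarith [key]
theorem Phi_zero (α β : ℝ) (u : ℤ → ℤ → ℝ) (h1 : ∀ k, u (-1) k = u 0 k) (k : ℤ) :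
    Phi α β u 0 k = -(α * u 0 k ^ 2 - α * β ^ 2 / 2 * (u 0 (k + 1) - u 0 k) ^ 2
      + α * β ^ 2 * ((u 0 (k + 1) - u 0 k + (u 0 k - u 0 (k - 1))) / 2) ^ 2
      - β ^ 2 * (α ^ 2 + β ^ 2) / 8 * (u 0 (k + 1) - u 0 k - (u 0 k - u 0 (k - 1))) ^ 2)
      + α * β * (u 0 (k + 1) * u 0 k - u 0 k * u 0 (k - 1)) := by
  simp only [Phi, gg, zz', L2, D20, D1p, D1m, D2p, D2m, add_sub_cancel_right, sub_add_cancel,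
    zero_sub, neg_add_cancel, h1]
  ring

theorem Psi_zero (α β : ℝ) (u : ℤ → ℤ → ℝ) (h1 : ∀ j, u j (-1) = u j 0) (j : ℤ) :
    Psi α β u j 0 = -(β * u j 0 ^ 2 - β * α ^ 2 / 2 * (u (j + 1) 0 - u j 0) ^ 2
      + β * α ^ 2 * ((u (j + 1) 0 - u j 0 + (u j 0 - u (j - 1) 0)) / 2) ^ 2
      - α ^ 2 * (β ^ 2 + α ^ 2) / 8 * (u (j + 1) 0 - u j 0 - (u j 0 - u (j - 1) 0)) ^ 2) := by
  simp only [Psi, gg, zz, L1, D10, D1p, D1m, D2p, D2m, add_sub_cancel_right, sub_add_cancel,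
    zero_sub, neg_add_cancel, h1]
  ring

theorem core (α β : ℝ) (hα : α < 0) (hβ : β < 0) (hC : α ^ 2 + β ^ 2 ≤ 1 / 2)
    (u : ℤ → ℤ → ℝ) (hE : EE u) (h1 : ∀ k, u (-1) k = u 0 k) (h2 : ∀ j, u j (-1) = u j 0)
    (u' : ℤ → ℤ → ℝ) (hs' : Summable (fun p : ℕ × ℕ => (u' (p.1 : ℤ) (p.2 : ℤ)) ^ 2))
    (hstep : ∀ j k : ℕ, u' j k = u j k - wop α β u j k + vop α β u j k) :
    sqQ u' - sqQ u + (-α) / 8 * (∑' k : ℕ, (u 0 (k : ℤ)) ^ 2)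
      + (-β) / 8 * (∑' j : ℕ, (u (j : ℤ) 0) ^ 2)
      + β ^ 2 / 32 * (α ^ 2 + β ^ 2) * (∑' k : ℕ, (L2 u 0 (k : ℤ)) ^ 2)
      + α ^ 2 / 32 * (α ^ 2 + β ^ 2) * (∑' j : ℕ, (L1 u (j : ℤ) 0) ^ 2) ≤ 0 := by
  have hPhi := Phi_PP α β hE
  have hPsi := Psi_PP α β hE
  have hle := hasSum_le (fun p : ℕ × ℕ => (by
      have e := pointwise α β u p.1 p.2
      have n := SS_nonneg α β hC u p.1 p.2
      rw [← hstep] at e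
      linarith : u' (p.1 : ℤ) (p.2 : ℤ) ^ 2 - u (p.1 : ℤ) (p.2 : ℤ) ^ 2 ≤
        (Phi α β u ((p.1 : ℤ) + 1) (p.2 : ℤ) - Phi α β u (p.1 : ℤ) (p.2 : ℤ))
        + (Psi α β u (p.1 : ℤ) ((p.2 : ℤ) + 1) - Psi α β u (p.1 : ℤ) (p.2 : ℤ))))
    (hs'.hasSum.sub hE.sq.nat.hasSum) ((tel1 hPhi).add (tel2 hPsi))
  have hsq1 : sqQ u' = ∑' p : ℕ × ℕ, (u' (p.1 : ℤ) (p.2 : ℤ)) ^ 2 := rfl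
  have hsq2 : sqQ u = ∑' p : ℕ × ℕ, (u (p.1 : ℤ) (p.2 : ℤ)) ^ 2 := rfl
  rw [← hsq1, ← hsq2] at hle
  have r1 : Summable fun k : ℕ => u 0 (k : ℤ) ^ 2 := hE.sq.row 0
  have r2 : Summable fun j : ℕ => u (j : ℤ) 0 ^ 2 := hE.sq.col 0
  have o1 := oneD α β hα hβ hC (fun k => u 0 k) r1 (h2 0)
  have o2 := oneD β α hβ hα (by linarith) (fun j => u j 0) r2 (h1 0)
  have hm : Summable fun k : ℕ => u 0 (k : ℤ) * u 0 ((k : ℤ) - 1) := (hE.mul hE.s2).row 0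
  have ht := tel0 hm
  have hmt : Summable fun k : ℕ => (u 0 ((k : ℤ) + 1) * u 0 (k : ℤ) - u 0 (k : ℤ) * u 0 ((k : ℤ) - 1)) := by
    have := ((summable_nat_add_iff 1).mpr hm).sub hm
    simpa using this
  simp only [Nat.cast_add, Nat.cast_one, add_sub_cancel_right, Nat.cast_zero, zero_sub, h2] at ht
  have sP : ∑' k : ℕ, Phi α β u 0 (k : ℤ) = -(∑' k : ℕ, (α * u 0 k ^ 2 - α * β ^ 2 / 2 * (u 0 (k + 1) - u 0 k) ^ 2
      + α * β ^ 2 * ((u 0 (k + 1) - u 0 k + (u 0 k - u 0 (k - 1))) / 2) ^ 2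
      - β ^ 2 * (α ^ 2 + β ^ 2) / 8 * (u 0 (k + 1) - u 0 k - (u 0 k - u 0 (k - 1))) ^ 2))
      - α * β * u 0 0 ^ 2 := by
    have hs := hPhi.row 0
    have e := (hs.hasSum.sub (hmt.mul_left (α * β)).hasSum).tsum_eq
    rw [tsum_mul_left, ht] at e
    rw [← tsum_neg]
    have e2 : ∀ k : ℕ, -(α * u 0 (k : ℤ) ^ 2 - α * β ^ 2 / 2 * (u 0 (k + 1) - u 0 k) ^ 2
      + α * β ^ 2 * ((u 0 (k + 1) - u 0 k + (u 0 k - u 0 (k - 1))) / 2) ^ 2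
      - β ^ 2 * (α ^ 2 + β ^ 2) / 8 * (u 0 (k + 1) - u 0 k - (u 0 k - u 0 (k - 1))) ^ 2)
      = Phi α β u 0 (k : ℤ) - α * β * (u 0 ((k : ℤ) + 1) * u 0 (k : ℤ) - u 0 (k : ℤ) * u 0 ((k : ℤ) - 1)) := by
      intro k; rw [Phi_zero α β u h1]; ring
    rw [tsum_congr e2, e]; ring
  have sQ : ∑' j : ℕ, Psi α β u (j : ℤ) 0 = -(∑' j : ℕ, (β * u j 0 ^ 2 - β * α ^ 2 / 2 * (u (j + 1) 0 - u j 0) ^ 2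
      + β * α ^ 2 * ((u (j + 1) 0 - u j 0 + (u j 0 - u (j - 1) 0)) / 2) ^ 2
      - α ^ 2 * (β ^ 2 + α ^ 2) / 8 * (u (j + 1) 0 - u j 0 - (u j 0 - u (j - 1) 0)) ^ 2)) := by
    rw [← tsum_neg]
    exact tsum_congr fun j => Psi_zero α β u h2 j
  have l2 : ∀ k : ℕ, L2 u 0 (k : ℤ) ^ 2 = (u 0 (k + 1) - u 0 k - (u 0 k - u 0 (k - 1))) ^ 2 := by
    intro k; simp only [L2, D2p, D2m, add_sub_cancel_right]
  have l1 : ∀ j : ℕ, L1 u (j : ℤ) 0 ^ 2 = (u (j + 1) 0 - u j 0 - (u j 0 - u (j - 1) 0)) ^ 2 := by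
    intro k; simp only [L1, D1p, D1m, add_sub_cancel_right]
  rw [tsum_congr l1, tsum_congr l2]
  rw [sP, sQ] at hle
  linarith

/-- Theorem 2: stability of the Lax-Wendroff scheme in the quarter-space with the
Neumann extrapolation boundary conditions and the corner extrapolation condition. -/
theorem quarterspace_stability (a b lam mu : ℝ) (ha : a < 0) (hb : b < 0)
    (hlam : 0 < lam) (hmu : 0 < mu)
    (hCFL : (lam * a) ^ 2 + (mu * b) ^ 2 ≤ 1 / 2)
    (u u' : ℤ → ℤ → ℝ) (hu : memQ u) (hu' : memQ u')
    (hstep : ∀ j : ℤ, 0 ≤ j → ∀ k : ℤ, 0 ≤ k →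
      u' j k = u j k - wop (lam * a) (mu * b) u j k + vop (lam * a) (mu * b) u j k) :
    sqQ u' - sqQ u + lam * |a| / 8 * (∑' k : ℕ, (u 0 (k : ℤ)) ^ 2)
      + mu * |b| / 8 * (∑' j : ℕ, (u (j : ℤ) 0) ^ 2)
      + (mu * b) ^ 2 / 32 * ((lam * a) ^ 2 + (mu * b) ^ 2) * (∑' k : ℕ, (L2 u 0 (k : ℤ)) ^ 2)
      + (lam * a) ^ 2 / 32 * ((lam * a) ^ 2 + (mu * b) ^ 2) * (∑' j : ℕ, (L1 u (j : ℤ) 0) ^ 2)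
      ≤ 0 := by
  have hα : lam * a < 0 := mul_neg_of_pos_of_neg hlam ha
  have hβ : mu * b < 0 := mul_neg_of_pos_of_neg hmu hb
  have hUe := UU_eq hu
  have hst : ∀ j k : ℕ, u' j k = UU u j k - wop (lam * a) (mu * b) (UU u) j k
      + vop (lam * a) (mu * b) (UU u) j k := by
    intro j k
    rw [hstep j (by omega) k (by omega)]
    simp only [wop, vop, L1, L2, D10, D20, D1p, D1m, D2p, D2m, add_sub_cancel_right,
      sub_add_cancel]
    have hj : (0 : ℤ) ≤ j := by omega
    have hk : (0 : ℤ) ≤ k := by omega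
    generalize (j : ℤ) = j at *
    generalize (k : ℤ) = k at *
    rw [hUe (j - 1) (k - 1) (by omega) (by omega), hUe (j - 1) k (by omega) (by omega),
      hUe (j - 1) (k + 1) (by omega) (by omega), hUe j (k - 1) (by omega) (by omega),
      hUe j k (by omega) (by omega), hUe j (k + 1) (by omega) (by omega),
      hUe (j + 1) (k - 1) (by omega) (by omega), hUe (j + 1) k (by omega) (by omega),
      hUe (j + 1) (k + 1) (by omega) (by omega)]
  have main := core (lam * a) (mu * b) hα hβ hCFL (UU u) (UU_EE hu.2.2) (UU_b1 u) (UU_b2 u)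
    u' hu'.2.2 hst
  have e0 : sqQ (UU u) = sqQ u := by
    unfold sqQ
    exact tsum_congr fun p => by rw [hUe _ _ (by omega) (by omega)]
  have e1 : ∑' k : ℕ, (UU u 0 (k : ℤ)) ^ 2 = ∑' k : ℕ, (u 0 (k : ℤ)) ^ 2 :=
    tsum_congr fun k => by rw [hUe _ _ (by omega) (by omega)]
  have e2 : ∑' k : ℕ, (UU u (k : ℤ) 0) ^ 2 = ∑' k : ℕ, (u (k : ℤ) 0) ^ 2 :=
    tsum_congr fun k => by rw [hUe _ _ (by omega) (by omega)]
  have e3 : ∑' k : ℕ, (L2 (UU u) 0 (k : ℤ)) ^ 2 = ∑' k : ℕ, (L2 u 0 (k : ℤ)) ^ 2 :=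
    tsum_congr fun k => by
      simp only [L2, D2p, D2m]
      rw [hUe _ _ (by omega) (by omega), hUe _ _ (by omega) (by omega),
        hUe _ _ (by omega) (by omega), hUe _ _ (by omega) (by omega)]
  have e4 : ∑' k : ℕ, (L1 (UU u) (k : ℤ) 0) ^ 2 = ∑' k : ℕ, (L1 u (k : ℤ) 0) ^ 2 :=
    tsum_congr fun k => by
      simp only [L1, D1p, D1m]
      rw [hUe _ _ (by omega) (by omega), hUe _ _ (by omega) (by omega),
        hUe _ _ (by omega) (by omega), hUe _ _ (by omega) (by omega)]
  rw [e0, e1, e2, e3, e4] at main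
  rw [abs_of_neg ha, abs_of_neg hb]
  linarith
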